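/- arXiv:1007.3460 — 4 statements merged into one kernel-verified Lean document; each statement's English description precedes it below -/
import Mathlib

section
/- For every complex number β with Re β > −1, one has ∫_{−π/2}^{π/2} (1 + e^{−2ix})^β / log(1 + e^{−2ix}) dx = (π/2) · (1 + 2β). -/
open Real Complex MeasureTheory

lemma aux_slit {z : ℂ} (hz : ‖z‖ < 1) : 1 + z ∈ Complex.slitPlane :=
  Complex.mem_slitPlane_of_norm_lt_one hz

lemma aux_log_ne {z : ℂ} (hz : ‖z‖ < 1) (h0 : z ≠ 0) : Complex.log (1 + z) ≠ 0 := by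
  intro h
  have h1 : 1 + z ≠ 0 := Complex.slitPlane_ne_zero (aux_slit hz)
  have := Complex.exp_log h1
  rw [h, Complex.exp_zero] at this
  apply h0
  linear_combination -this

/-- `log(1+z)/z` with the singularity removed. -/
noncomputable def auxL : ℂ → ℂ := dslope (fun z => Complex.log (1 + z)) 0

lemma auxL_mul (z : ℂ) : z * auxL z = Complex.log (1 + z) := by
  have := sub_smul_dslope (fun z => Complex.log (1 + z)) 0 z
  simpa [auxL] using this

lemma hasDerivAt_log1 {z : ℂ} (hz : ‖z‖ < 1) :
    HasDerivAt (fun z => Complex.log (1 + z)) (1 + z)⁻¹ z := by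
  simpa using ((hasDerivAt_id z).const_add 1).clog (aux_slit hz)

lemma auxL_diff : DifferentiableOn ℂ auxL (Metric.ball 0 1) := by
  refine (Complex.differentiableOn_dslope (Metric.ball_mem_nhds _ one_pos)).mpr ?_
  intro z hz
  exact (hasDerivAt_log1 (by simpa using hz)).differentiableAt.differentiableWithinAt

lemma auxL_zero : auxL 0 = 1 := by
  rw [auxL, dslope_same, (hasDerivAt_log1 (z := 0) (by simp)).deriv]
  simp

lemma auxL_ne {z : ℂ} (hz : ‖z‖ < 1) : auxL z ≠ 0 := by
  by_cases h0 : z = 0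
  · subst h0; simp [auxL_zero]
  · intro h
    apply aux_log_ne hz h0
    rw [← auxL_mul, h, mul_zero]

lemma auxL_deriv : HasDerivAt auxL (-1/2) 0 := by
  have hd : ∀ z ∈ Metric.ball (0:ℂ) 1, HasDerivAt auxL (deriv auxL z) z := fun z hz =>
    (auxL_diff.differentiableAt (Metric.isOpen_ball.mem_nhds hz)).hasDerivAt
  have hd' : HasDerivAt (deriv auxL) (deriv (deriv auxL) 0) 0 :=
    ((auxL_diff.deriv Metric.isOpen_ball).differentiableAt
      (Metric.ball_mem_nhds _ one_pos)).hasDerivAt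
  have h0 := hd 0 (by simp)
  have e : ∀ z ∈ Metric.ball (0:ℂ) 1, auxL z + z * deriv auxL z = (1 + z)⁻¹ := by
    intro z hz
    have h1 := (hasDerivAt_id z).mul (hd z hz)
    have h2 := hasDerivAt_log1 (z := z) (by simpa using hz)
    have h3 : (id * auxL) = (fun z => Complex.log (1 + z)) := by
      funext z; simpa using auxL_mul z
    rw [h3] at h1
    simpa using h1.unique h2
  have h1 : HasDerivAt (fun z => auxL z + z * deriv auxL z) (deriv auxL 0 + deriv auxL 0) 0 := by
    have := h0.add ((hasDerivAt_id (0:ℂ)).mul hd')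
    simpa using! this
  have h2 : HasDerivAt (fun z : ℂ => (1 + z)⁻¹) (-1) 0 := by
    have := ((hasDerivAt_id (0:ℂ)).const_add 1).inv (by simp)
    simpa using! this
  have h3 := (h1.congr_of_eventuallyEq (f₁ := fun z : ℂ => (1 + z)⁻¹) (by
    filter_upwards [Metric.ball_mem_nhds (0:ℂ) one_pos] with z hz
    exact (e z hz).symm)).unique h2
  have : deriv auxL 0 = -1/2 := by linear_combination h3 / 2
  rwa [this] at h0

lemma auxH_deriv (β : ℂ) : HasDerivAt (fun z => (1 + z) ^ β / auxL z) (β + 1/2) 0 := by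
  have h1 : HasDerivAt (fun z : ℂ => (1 + z) ^ β) β 0 := by
    have := ((hasDerivAt_id (0:ℂ)).const_add 1).cpow_const (c := β) (by simp)
    simpa using! this
  have := h1.div auxL_deriv (by simp [auxL_zero])
  convert! this using 1
  simp [auxL_zero]; ring

lemma auxH_diff (β : ℂ) :
    DifferentiableOn ℂ (fun z => (1 + z) ^ β / auxL z) (Metric.ball 0 1) := by
  intro z hz
  have hz' : ‖z‖ < 1 := by simpa using hz
  refine DifferentiableWithinAt.div ?_ (auxL_diff z hz) (auxL_ne hz')
  have := ((hasDerivAt_id z).const_add 1).cpow_const (c := β) (aux_slit hz')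
  exact this.differentiableAt.differentiableWithinAt

/-- The integral over a circle of radius `r < 1`. -/
lemma aux_int (β : ℂ) {r : ℝ} (h0 : 0 < r) (h1 : r < 1) :
    ∫ x in (-(π/2))..(π/2),
        (1 + r * Complex.exp (-2 * Complex.I * x)) ^ β /
          Complex.log (1 + r * Complex.exp (-2 * Complex.I * x))
    = (π / 2) * (1 + 2 * β) := by
  have hc := two_pi_I_inv_smul_circleIntegral_sub_sq_inv_smul_of_differentiable
    (U := Metric.ball (0:ℂ) 1) Metric.isOpen_ball (c := 0) (w₀ := 0) (R := r)
    (Metric.closedBall_subset_ball h1) (auxH_diff β) (by simpa using h0)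
  rw [(auxH_deriv β).deriv, circleIntegral] at hc
  set G : ℝ → ℂ := fun θ => (1 + circleMap 0 r θ) ^ β / Complex.log (1 + circleMap 0 r θ) with hG
  have e1 : ∀ θ : ℝ, deriv (circleMap 0 r) θ • ((circleMap 0 r θ - 0) ^ 2)⁻¹ •
      ((1 + circleMap 0 r θ) ^ β / auxL (circleMap 0 r θ)) = Complex.I * G θ := by
    intro θ
    have hz : circleMap 0 r θ ≠ 0 := circleMap_ne_center h0.ne'
    have hn : ‖circleMap 0 r θ‖ < 1 := by simpa [abs_of_pos h0] using h1
    have hL := auxL_ne hn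
    rw [hG]
    simp only [deriv_circleMap, smul_eq_mul, sub_zero, ← auxL_mul]
    field_simp
  simp_rw [e1] at hc
  rw [intervalIntegral.integral_const_mul] at hc
  have per : Function.Periodic G (2 * π) := fun θ => by
    simp only [hG, periodic_circleMap 0 r θ]
  have hs := per.intervalIntegral_add_eq 0 (-π)
  have e2 : ∀ x : ℝ, (1 + r * Complex.exp (-2 * Complex.I * x)) ^ β /
          Complex.log (1 + r * Complex.exp (-2 * Complex.I * x)) = G ((-2) * x) := by
    intro x
    simp only [hG, circleMap, zero_add]
    push_cast
    rw [show (-2 * Complex.I * x : ℂ) = -2 * x * Complex.I by ring]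
  simp_rw [e2]
  rw [intervalIntegral.integral_comp_mul_left _ (by norm_num), intervalIntegral.integral_symm]
  rw [show (-2 * (π/2) : ℝ) = -π by ring, show (-2 * -(π/2) : ℝ) = -π + 2 * π by ring, ← hs]
  rw [zero_add, smul_eq_mul] at *
  have hp : (π : ℂ) ≠ 0 := by exact_mod_cast Real.pi_ne_zero
  have hI := Complex.I_ne_zero
  have : (∫ θ in (0:ℝ)..(2 * π), G θ) = 2 * π * (β + 1/2) := by
    rw [← hc]; field_simp
  rw [this, Complex.real_smul]
  push_cast
  ring

lemma aux_norm_log {z : ℂ} (hz : 1/2 ≤ ‖z‖) (h1 : 1 + z ≠ 0) :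
    1/4 ≤ ‖Complex.log (1 + z)‖ := by
  by_contra! h
  have := Complex.norm_exp_sub_one_le (x := Complex.log (1 + z)) (by linarith)
  rw [Complex.exp_log h1, add_sub_cancel_left] at this
  linarith

lemma aux_norm_one_add (x : ℝ) (hx : 0 ≤ Real.cos x) :
    ‖1 + Complex.exp (-2 * Complex.I * x)‖ = 2 * Real.cos x := by
  have : 1 + Complex.exp (-2 * Complex.I * x)
      = ((2 * Real.cos x : ℝ) : ℂ) * Complex.exp ((-x : ℝ) * Complex.I) := by
    push_cast
    rw [Complex.two_cos, add_mul, ← Complex.exp_add, ← Complex.exp_add,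
      show (x : ℂ) * Complex.I + -x * Complex.I = 0 by ring,
      show -(x : ℂ) * Complex.I + -x * Complex.I = -2 * Complex.I * x by ring, Complex.exp_zero]
  rw [this, norm_mul, Complex.norm_exp_ofReal_mul_I, mul_one, Complex.norm_real,
    Real.norm_of_nonneg (by positivity)]

lemma aux_norm_exp (x : ℝ) : ‖Complex.exp (-2 * Complex.I * x)‖ = 1 := by
  rw [show (-2 * Complex.I * x : ℂ) = (-2 * x : ℝ) * Complex.I by push_cast; ring,
    Complex.norm_exp_ofReal_mul_I]

/-- The dominating function. -/
noncomputable def auxB (β : ℂ) (x : ℝ) : ℝ :=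
  4 * Real.exp (π * |β.im|) *
    (2 ^ |β.re| + ((1 - 2 / π * x) ^ β.re + (1 + 2 / π * x) ^ β.re))

lemma auxB_int (β : ℂ) (hβ : -1 < β.re) :
    IntervalIntegrable (auxB β) volume (-(π/2)) (π/2) := by
  have hp := Real.pi_ne_zero
  have h : ∀ a b, IntervalIntegrable (fun x : ℝ => (1 + x) ^ β.re) volume a b := by
    intro a b
    simpa using (intervalIntegral.intervalIntegrable_rpow' hβ (a := 1 + a) (b := 1 + b)).comp_add_left 1
  have h1 : IntervalIntegrable (fun x : ℝ => (1 + 2 / π * x) ^ β.re) volume (-(π/2)) (π/2) := by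
    have := (h (-1) 1).comp_mul_left (c := 2 / π)
    convert! this using 1 <;> field_simp
  have h2 : IntervalIntegrable (fun x : ℝ => (1 - 2 / π * x) ^ β.re) volume (-(π/2)) (π/2) := by
    have := (h 1 (-1)).comp_mul_left (c := -(2 / π))
    convert! this using 1
    · funext x; congr 1; ring
    · field_simp
    · field_simp
  exact (intervalIntegrable_const.add (h2.add h1)).const_mul _

lemma aux_rpow {b y c : ℝ} (hc : 0 < c) (hcy : c ≤ y) (hy : y ≤ 2) :
    y ^ b ≤ 2 ^ |b| + c ^ b := by
  have hy0 : 0 < y := hc.trans_le hcy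
  rcases le_total 0 b with hb | hb
  · rw [abs_of_nonneg hb]
    have := Real.rpow_le_rpow hy0.le hy hb
    have := Real.rpow_nonneg hc.le b
    linarith
  · have := Real.rpow_le_rpow_of_nonpos hc hcy hb
    have := Real.rpow_nonneg (zero_le_two (α := ℝ)) |b|
    linarith

lemma aux_bound (β : ℂ) {r x : ℝ} (hr : 1/2 ≤ r) (hr1 : r < 1) (hx : x ∈ Set.Ioo (-(π/2)) (π/2)) :
    ‖(1 + r * Complex.exp (-2 * Complex.I * x)) ^ β /
          Complex.log (1 + r * Complex.exp (-2 * Complex.I * x))‖ ≤ auxB β x := by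
  have hcos : 0 < Real.cos x := Real.cos_pos_of_mem_Ioo hx
  have hN := aux_norm_one_add x hcos.le
  have hE := aux_norm_exp x
  set z := Complex.exp (-2 * Complex.I * x)
  have hrz : ‖(r : ℂ) * z‖ = r := by
    rw [norm_mul, hE, mul_one, Complex.norm_real, Real.norm_of_nonneg (by linarith)]
  have hw0 : 1 + r * z ≠ 0 := Complex.slitPlane_ne_zero (aux_slit (by rw [hrz]; exact hr1))
  have hlog := aux_norm_log (z := r * z) (by rw [hrz]; exact hr) hw0
  have hup : ‖1 + r * z‖ ≤ 2 := by
    have := norm_add_le 1 (r * z)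
    rw [hrz, norm_one] at this
    linarith
  have hlo : Real.cos x ≤ ‖1 + r * z‖ := by
    have h1 : 1 - r ≤ ‖1 + r * z‖ := by
      have := norm_sub_norm_le (1 : ℂ) (-(r * z))
      rw [norm_neg, hrz, norm_one, sub_neg_eq_add] at this
      exact this
    have h2 : ‖1 + z‖ ≤ ‖1 + r * z‖ + (1 - r) := by
      have := norm_add_le (1 + r * z) ((1 - r : ℝ) * z)
      rw [norm_mul, hE, mul_one, Complex.norm_real, Real.norm_of_nonneg (by linarith)] at this
      rwa [show (1 + r * z) + ((1 - r : ℝ) : ℂ) * z = 1 + z by push_cast; ring] at this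
    linarith
  have hp := Real.pi_pos
  have p1 : 0 < 1 - 2 / π * x := by
    have := hx.2
    have : 2 / π * x < 2 / π * (π / 2) := by gcongr
    rw [show 2 / π * (π / 2) = 1 by field_simp] at this
    linarith
  have p2 : 0 < 1 + 2 / π * x := by
    have : -x < π / 2 := by linarith [hx.1]
    have : 2 / π * -x < 2 / π * (π / 2) := by gcongr
    rw [show 2 / π * (π / 2) = 1 by field_simp] at this
    linarith
  have hpow : ‖1 + r * z‖ ^ β.re ≤
      2 ^ |β.re| + ((1 - 2 / π * x) ^ β.re + (1 + 2 / π * x) ^ β.re) := by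
    have q1 := Real.rpow_nonneg p1.le β.re
    have q2 := Real.rpow_nonneg p2.le β.re
    rcases le_total 0 x with h | h
    · have := Real.one_sub_mul_le_cos h hx.2.le
      have := aux_rpow (b := β.re) p1 (this.trans hlo) hup
      linarith
    · have := Real.one_add_mul_le_cos hx.1.le h
      have := aux_rpow (b := β.re) p2 (this.trans hlo) hup
      linarith
  have hexp : (Real.exp ((1 + r * z).arg * β.im))⁻¹ ≤ Real.exp (π * |β.im|) := by
    rw [← Real.exp_neg]
    gcongr
    calc -((1 + r * z).arg * β.im) ≤ |(1 + r * z).arg * β.im| := neg_le_abs _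
      _ ≤ _ := by rw [abs_mul]; gcongr; exact Complex.abs_arg_le_pi _
  rw [norm_div, Complex.norm_cpow_of_ne_zero hw0, auxB, div_eq_mul_inv, div_eq_mul_inv]
  have hinv : ‖Complex.log (1 + r * z)‖⁻¹ ≤ 4 := by
    have := inv_anti₀ (by norm_num) hlog
    norm_num at this
    exact this
  calc _ ≤ (2 ^ |β.re| + ((1 - 2 / π * x) ^ β.re + (1 + 2 / π * x) ^ β.re)) *
        Real.exp (π * |β.im|) * 4 := by gcongr
    _ = _ := by ring

lemma aux_lim (β : ℂ) {x : ℝ} (hx : x ∈ Set.Ioo (-(π/2)) (π/2)) :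
    Filter.Tendsto (fun r : ℝ => (1 + r * Complex.exp (-2 * Complex.I * x)) ^ β /
          Complex.log (1 + r * Complex.exp (-2 * Complex.I * x))) (nhdsWithin 1 (Set.Iio 1))
      (nhds ((1 + Complex.exp (-2 * Complex.I * x)) ^ β /
          Complex.log (1 + Complex.exp (-2 * Complex.I * x)))) := by
  have hcos : 0 < Real.cos x := Real.cos_pos_of_mem_Ioo hx
  have hs : 1 + Complex.exp (-2 * Complex.I * x) ∈ Complex.slitPlane := by
    left
    rw [show (-2 * Complex.I * x : ℂ) = (-(2 * x) : ℝ) * Complex.I by push_cast; ring,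
      Complex.add_re, Complex.exp_ofReal_mul_I_re, Real.cos_neg, Real.cos_two_mul]
    simp
    positivity
  have hlog : Complex.log (1 + Complex.exp (-2 * Complex.I * x)) ≠ 0 := by
    have := aux_norm_log (z := Complex.exp (-2 * Complex.I * x))
      (by rw [aux_norm_exp]; norm_num) (Complex.slitPlane_ne_zero hs)
    intro h
    rw [h, norm_zero] at this
    norm_num at this
  have hc : ContinuousAt (fun r : ℝ => (1 + r * Complex.exp (-2 * Complex.I * x)) ^ β /
          Complex.log (1 + r * Complex.exp (-2 * Complex.I * x))) 1 := by
    have hb : ContinuousAt (fun r : ℝ => (1 + r * Complex.exp (-2 * Complex.I * x))) 1 := by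
      fun_prop
    refine ContinuousAt.div (hb.cpow continuousAt_const (by simpa using hs))
      (hb.clog (by simpa using hs)) (by simpa using hlog)
  have := hc.tendsto.mono_left (nhdsWithin_le_nhds (s := Set.Iio 1))
  simpa using this

/-- For `Re β > -1`,
`∫_{-π/2}^{π/2} (1+e^{-2ix})^β / log(1+e^{-2ix}) dx = (π/2)(1 + 2β)`. -/
theorem integral_cpow_div_log (β : ℂ) (hβ : -1 < β.re) :
    ∫ x in (-(π/2))..(π/2),
        (1 + Complex.exp (-2 * Complex.I * x)) ^ β /
          Complex.log (1 + Complex.exp (-2 * Complex.I * x))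
    = (π / 2) * (1 + 2 * β) := by
  have hev : ∀ᶠ r : ℝ in nhdsWithin 1 (Set.Iio 1), 1/2 ≤ r ∧ r < 1 := by
    filter_upwards [Ioo_mem_nhdsLT (show (1/2 : ℝ) < 1 by norm_num)] with r hr
    exact ⟨hr.1.le, hr.2⟩
  have hae : ∀ᵐ x : ℝ, x ∈ Set.uIoc (-(π/2)) (π/2) → x ∈ Set.Ioo (-(π/2)) (π/2) := by
    have : ∀ᵐ x : ℝ, x ≠ π/2 := by simp [ae_iff]
    filter_upwards [this] with x hx h
    rw [Set.uIoc_of_le (by linarith [Real.pi_pos])] at h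
    exact ⟨h.1, lt_of_le_of_ne h.2 hx⟩
  have key := intervalIntegral.tendsto_integral_filter_of_dominated_convergence
    (μ := volume) (a := -(π/2)) (b := π/2) (l := nhdsWithin (1:ℝ) (Set.Iio 1))
    (F := fun (r : ℝ) (x : ℝ) => (1 + r * Complex.exp (-2 * Complex.I * x)) ^ β /
          Complex.log (1 + r * Complex.exp (-2 * Complex.I * x)))
    (f := fun x : ℝ => (1 + Complex.exp (-2 * Complex.I * x)) ^ β /
          Complex.log (1 + Complex.exp (-2 * Complex.I * x)))
    (auxB β)
    (Filter.Eventually.of_forall fun r => by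
      apply Measurable.aestronglyMeasurable
      fun_prop)
    (by
      filter_upwards [hev] with r hr
      filter_upwards [hae] with x hx h
      exact aux_bound β hr.1 hr.2 (hx h))
    (auxB_int β hβ)
    (by
      filter_upwards [hae] with x hx h
      exact aux_lim β (hx h))
  refine tendsto_nhds_unique key ?_
  refine tendsto_const_nhds.congr' ?_
  filter_upwards [hev] with r hr
  exact (aux_int β (by linarith [hr.1]) hr.2).symm
end

section
/- ∫_0^{π/2} ln(x² + ln²(2 cos x)) dx = 0. -/
open Real

namespace LogCosAux
open Filter Topology MeasureTheory

/-- The logarithm `log (1+z)` divided by `z`, extended across `0`. -/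
noncomputable def g : ℂ → ℂ := dslope (fun z => Complex.log (1 + z)) 0

lemma log_lower {z : ℂ} (hz : 1 / 2 ≤ ‖z‖) (h0 : 1 + z ≠ 0) : 1 / 4 ≤ ‖Complex.log (1 + z)‖ := by
  by_contra! h
  have h1 := Complex.norm_exp_sub_one_le (x := Complex.log (1 + z)) (by linarith)
  rw [Complex.exp_log h0] at h1
  simp only [add_sub_cancel_left] at h1
  linarith

lemma log_ne {z : ℂ} (hz : z ≠ 0) (h0 : 1 + z ≠ 0) : Complex.log (1 + z) ≠ 0 := by
  intro h
  have := Complex.exp_log h0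
  rw [h, Complex.exp_zero] at this
  apply hz
  linear_combination -this

lemma slit {r : ℝ} (hr : 0 < r) (hr1 : r < 1) (θ : ℝ) :
    1 + circleMap 0 r θ ∈ Complex.slitPlane := by
  apply Complex.mem_slitPlane_of_norm_lt_one
  simpa [abs_of_pos hr] using hr1

lemma g_of_ne {z : ℂ} (hz : z ≠ 0) : g z = Complex.log (1 + z) / z := by
  unfold g
  rw [dslope_of_ne _ hz, slope_def_field]
  simp

lemma g_zero : g 0 = 1 := by
  unfold g
  rw [dslope_same]
  have : HasDerivAt (fun z : ℂ => Complex.log (1 + z)) (1 / (1 + 0)) 0 :=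
    ((hasDerivAt_id (0:ℂ)).const_add 1).clog (by simp)
  simpa using this.deriv

lemma g_diff : DifferentiableOn ℂ g (Metric.ball 0 1) := by
  unfold g
  rw [Complex.differentiableOn_dslope (Metric.ball_mem_nhds _ one_pos)]
  intro z hz
  have : 1 + z ∈ Complex.slitPlane := Complex.mem_slitPlane_of_norm_lt_one (by simpa using hz)
  exact ((differentiableAt_id.const_add 1).clog this).differentiableWithinAt

/-- The boundary function at radius `r`. -/
noncomputable def F (r θ : ℝ) : ℝ := Real.log ‖Complex.log (1 + circleMap 0 r θ)‖

lemma F_cont {r : ℝ} (hr : 0 < r) (hr1 : r < 1) : Continuous (F r) := by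
  unfold F
  refine Continuous.log ?_ ?_
  · refine Continuous.norm (Continuous.clog (by fun_prop) (slit hr hr1))
  · intro θ
    rw [norm_ne_zero_iff]
    exact log_ne (circleMap_ne_center hr.ne') (Complex.slitPlane_ne_zero (slit hr hr1 θ))

lemma F_int_full {r : ℝ} (hr : 0 < r) (hr1 : r < 1) :
    ∫ θ in (0:ℝ)..(2 * π), F r θ = 2 * π * Real.log r := by
  have hsub : Metric.closedBall (0:ℂ) |r| ⊆ Metric.ball 0 1 := by
    rw [abs_of_pos hr]; exact Metric.closedBall_subset_ball hr1
  have key : Real.circleAverage (fun z => Real.log ‖g z‖) 0 r = Real.log ‖g 0‖ := by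
    apply AnalyticOnNhd.circleAverage_log_norm_of_ne_zero
    · exact (g_diff.analyticOnNhd Metric.isOpen_ball).mono hsub
    · intro z hz
      by_cases h : z = 0
      · rw [h, g_zero]; exact one_ne_zero
      · rw [g_of_ne h]
        have hz1 := hsub hz
        have : 1 + z ∈ Complex.slitPlane := Complex.mem_slitPlane_of_norm_lt_one (by simpa using hz1)
        exact div_ne_zero (log_ne h (Complex.slitPlane_ne_zero this)) h
  rw [g_zero, Real.circleAverage_def] at key
  have h2 : ∀ θ, Real.log ‖g (circleMap 0 r θ)‖ = F r θ - Real.log r := by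
    intro θ
    have hc : circleMap 0 r θ ≠ 0 := circleMap_ne_center hr.ne'
    have := log_ne hc (Complex.slitPlane_ne_zero (slit hr hr1 θ))
    rw [g_of_ne hc, norm_div, Real.log_div (norm_ne_zero_iff.2 this) (norm_ne_zero_iff.2 hc)]
    simp [F, abs_of_pos hr]
  simp only [h2] at key
  rw [intervalIntegral.integral_sub ((F_cont hr hr1).intervalIntegrable _ _) (by simp)] at key
  have hp := Real.pi_pos
  simp at key
  linarith

lemma F_symm {r : ℝ} (hr : 0 < r) (hr1 : r < 1) (θ : ℝ) : F r (2 * π - θ) = F r θ := by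
  unfold F
  have h : 1 + circleMap 0 r (2 * π - θ) = (starRingEnd ℂ) (1 + circleMap 0 r θ) := by
    have : circleMap 0 r (2 * π - θ) = circleMap 0 r (-θ) := by
      rw [show 2 * π - θ = -θ + 2 * π by ring]; exact periodic_circleMap 0 r (-θ)
    rw [this]
    simp [circleMap, ← Complex.exp_conj]
  rw [h, Complex.log_conj _ (Complex.slitPlane_arg_ne_pi (slit hr hr1 θ)), Complex.norm_conj]

lemma F_int {r : ℝ} (hr : 0 < r) (hr1 : r < 1) :
    ∫ θ in (0:ℝ)..π, F r θ = π * Real.log r := by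
  have h1 := F_int_full hr hr1
  have hi := fun a b => (F_cont hr hr1).intervalIntegrable (μ := volume) a b
  rw [← intervalIntegral.integral_add_adjacent_intervals (hi 0 π) (hi π (2 * π))] at h1
  have h2 := intervalIntegral.integral_comp_sub_left (F r) (2 * π) (a := 0) (b := π)
  simp only [F_symm hr hr1] at h2
  rw [show 2 * π - π = π by ring, sub_zero] at h2
  linarith

lemma norm_lower {r : ℝ} (hr : 1 / 2 ≤ r) (θ : ℝ) :
    |Real.cos (θ / 2)| ≤ ‖1 + circleMap 0 r θ‖ := by
  apply abs_le_of_sq_le_sq _ (norm_nonneg _)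
  rw [← Complex.normSq_eq_norm_sq, Complex.normSq_apply]
  have hc : Real.cos θ = 2 * Real.cos (θ / 2) ^ 2 - 1 := by
    rw [← Real.cos_two_mul]; ring_nf
  have e1 : (circleMap 0 r θ).re = r * Real.cos θ := by
    simp [circleMap, Complex.exp_re]
  have e2 : (circleMap 0 r θ).im = r * Real.sin θ := by
    simp [circleMap, Complex.exp_im]
  simp only [Complex.add_re, Complex.add_im, Complex.one_re, Complex.one_im, e1, e2]
  have hs := Real.sin_sq_add_cos_sq θ
  have : (1 + r * Real.cos θ) * (1 + r * Real.cos θ) + (0 + r * Real.sin θ) * (0 + r * Real.sin θ)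
      = (1 - r) ^ 2 + 4 * r * Real.cos (θ / 2) ^ 2 := by
    linear_combination r ^ 2 * hs + 2 * r * hc
  rw [this]
  nlinarith [sq_nonneg (1 - r), sq_nonneg (Real.cos (θ / 2))]

lemma F_bound {r : ℝ} (hr : 1 / 2 ≤ r) (hr1 : r < 1) {θ : ℝ} (hc : Real.cos (θ / 2) ≠ 0) :
    ‖F r θ‖ ≤ Real.log 4 + (Real.log 2 + π - Real.log (Real.cos (θ / 2))) := by
  have hr0 : 0 < r := by linarith
  have hne := Complex.slitPlane_ne_zero (slit hr0 hr1 θ)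
  have hn : ‖circleMap 0 r θ‖ = r := by simp [abs_of_pos hr0]
  have hlow := log_lower (by rw [hn]; exact hr) hne
  have hl4 : -Real.log 4 ≤ F r θ := by
    rw [← Real.log_inv]
    exact Real.log_le_log (by norm_num) (by norm_num at hlow ⊢; exact hlow)
  have h4 : 0 < Real.log 4 := Real.log_pos (by norm_num)
  have h2 : 0 < Real.log 2 := Real.log_pos (by norm_num)
  have hcl : Real.log (Real.cos (θ / 2)) ≤ 0 := by
    rw [← Real.log_abs]
    exact Real.log_nonpos (abs_nonneg _) (Real.abs_cos_le_one _)
  have hA : Real.log (Real.cos (θ / 2)) ≤ Real.log ‖1 + circleMap 0 r θ‖ := by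
    rw [← Real.log_abs]
    exact Real.log_le_log (abs_pos.2 hc) (norm_lower hr θ)
  have hB : Real.log ‖1 + circleMap 0 r θ‖ ≤ Real.log 2 := by
    apply Real.log_le_log (norm_pos_iff.2 hne)
    have := norm_add_le (1:ℂ) (circleMap 0 r θ)
    rw [hn, norm_one] at this
    linarith
  have hup : F r θ ≤ ‖Complex.log (1 + circleMap 0 r θ)‖ := Real.log_le_self (norm_nonneg _)
  have hw := Complex.norm_le_abs_re_add_abs_im (Complex.log (1 + circleMap 0 r θ))
  rw [Complex.log_re, Complex.log_im] at hw
  have harg := Complex.abs_arg_le_pi (1 + circleMap 0 r θ)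
  have habs : |Real.log ‖1 + circleMap 0 r θ‖| ≤ Real.log 2 - Real.log (Real.cos (θ / 2)) := by
    rw [abs_le]; constructor <;> linarith
  have := Real.pi_pos
  rw [Real.norm_eq_abs, abs_le]
  constructor <;> linarith

lemma one_add_eq (x : ℝ) : 1 + circleMap 0 1 (2 * x) =
    ((2 * Real.cos x : ℝ) : ℂ) * (Real.cos x + Real.sin x * Complex.I) := by
  have : circleMap 0 1 (2 * x) = Complex.exp (x * Complex.I) ^ 2 := by
    rw [← Complex.exp_nat_mul]; simp [circleMap]; ring_nf
  rw [this, Complex.exp_mul_I]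
  push_cast
  have := Complex.sin_sq_add_cos_sq (x:ℂ)
  linear_combination Complex.sin x ^ 2 * Complex.I_sq - this

lemma F_one {x : ℝ} (hx0 : 0 ≤ x) (hx : x < π / 2) :
    F 1 (2 * x) = 1 / 2 * Real.log (x ^ 2 + Real.log (2 * Real.cos x) ^ 2) := by
  have hp := Real.pi_pos
  have hc : 0 < 2 * Real.cos x := by
    have := Real.cos_pos_of_mem_Ioo ⟨by linarith, hx⟩
    linarith
  unfold F
  have : Complex.log (1 + circleMap 0 1 (2 * x)) = ⟨Real.log (2 * Real.cos x), x⟩ := by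
    apply Complex.ext
    · rw [Complex.log_re, one_add_eq, norm_mul, Complex.norm_real, Real.norm_of_nonneg hc.le]
      have : ‖(Real.cos x + Real.sin x * Complex.I : ℂ)‖ = 1 := by
        push_cast
        rw [← Complex.exp_mul_I, Complex.norm_exp_ofReal_mul_I]
      rw [this, mul_one]
    · rw [Complex.log_im, one_add_eq]
      push_cast
      have := Complex.arg_mul_cos_add_sin_mul_I hc (θ := x) ⟨by linarith, by linarith⟩
      simpa using this
  rw [this, Complex.norm_eq_sqrt_sq_add_sq, Real.log_sqrt (by positivity), add_comm]
  ring

lemma F_tendsto {θ : ℝ} (h0 : 0 ≤ θ) (h : θ < π) :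
    Tendsto (fun r => F r θ) (𝓝[<] 1) (𝓝 (F 1 θ)) := by
  apply Filter.Tendsto.mono_left _ nhdsWithin_le_nhds
  have hp := Real.pi_pos
  have hs : 1 + circleMap 0 1 θ ∈ Complex.slitPlane := by
    left
    have hc : 0 < Real.cos (θ / 2) := Real.cos_pos_of_mem_Ioo ⟨by linarith, by linarith⟩
    have hcc : Real.cos θ = 2 * Real.cos (θ / 2) ^ 2 - 1 := by
      rw [← Real.cos_two_mul]; ring_nf
    have e1 : (circleMap 0 1 θ).re = Real.cos θ := by
      simp [circleMap, Complex.exp_re]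
    rw [Complex.add_re, e1, hcc, Complex.one_re]
    nlinarith
  have hne : Complex.log (1 + circleMap 0 1 θ) ≠ 0 :=
    log_ne (circleMap_ne_center one_ne_zero) (Complex.slitPlane_ne_zero hs)
  have : ContinuousAt (fun r => F r θ) 1 := by
    unfold F
    refine ContinuousAt.log (ContinuousAt.norm (ContinuousAt.clog ?_ hs)) (norm_ne_zero_iff.2 hne)
    unfold circleMap
    fun_prop
  exact this

lemma F_one_int : ∫ θ in (0:ℝ)..π, F 1 θ = 0 := by
  have hp := Real.pi_pos
  have hmem : Set.Ioo (1/2:ℝ) 1 ∈ 𝓝[<] (1:ℝ) := Ioo_mem_nhdsLT (by norm_num)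
  have hne : ∀ᵐ θ : ℝ ∂volume, θ ≠ π := Measure.ae_ne volume π
  have hT : Tendsto (fun r => ∫ θ in (0:ℝ)..π, F r θ) (𝓝[<] 1) (𝓝 (∫ θ in (0:ℝ)..π, F 1 θ)) := by
    apply intervalIntegral.tendsto_integral_filter_of_dominated_convergence
      (fun θ => Real.log 4 + (Real.log 2 + π - Real.log (Real.cos (θ / 2))))
    · filter_upwards [hmem] with r hr
      exact (F_cont (by linarith [hr.1]) hr.2).aestronglyMeasurable
    · filter_upwards [hmem] with r hr
      filter_upwards [hne] with θ hθ hI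
      rw [Set.uIoc_of_le hp.le] at hI
      have hlt : θ < π := lt_of_le_of_ne hI.2 hθ
      exact F_bound hr.1.le hr.2
        (Real.cos_pos_of_mem_Ioo ⟨by linarith [hI.1], by linarith⟩).ne'
    · have h2 : IntervalIntegrable (fun θ => Real.log (Real.cos (θ / 2))) volume 0 π := by
        have ha : AnalyticOnNhd ℝ (fun θ : ℝ => Real.cos (θ / 2)) Set.univ := by
          intro x _
          exact Real.analyticAt_cos.comp' (by fun_prop)
        exact (ha.mono (Set.subset_univ _)).meromorphicOn.intervalIntegrable_log
      exact intervalIntegrable_const.add (intervalIntegrable_const.sub h2)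
    · filter_upwards [hne] with θ hθ hI
      rw [Set.uIoc_of_le hp.le] at hI
      exact F_tendsto hI.1.le (lt_of_le_of_ne hI.2 hθ)
  have hL : Tendsto (fun r => ∫ θ in (0:ℝ)..π, F r θ) (𝓝[<] 1) (𝓝 0) := by
    have : Tendsto (fun r => π * Real.log r) (𝓝[<] 1) (𝓝 (π * Real.log 1)) :=
      ((Real.continuousAt_log one_ne_zero).tendsto.const_mul π).mono_left nhdsWithin_le_nhds
    rw [Real.log_one, mul_zero] at this
    refine this.congr' ?_
    filter_upwards [hmem] with r hr
    exact (F_int (by linarith [hr.1]) hr.2).symm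
  exact tendsto_nhds_unique hT hL

end LogCosAux

open LogCosAux in
/-- `∫_0^{π/2} ln(x² + ln²(2 cos x)) dx = 0`. -/
theorem integral_log_sq_add_log_sq_two_cos :
    ∫ x in (0:ℝ)..(π/2),
        Real.log (x ^ 2 + Real.log (2 * Real.cos x) ^ 2)
    = 0 := by
  have hp := Real.pi_pos
  have h : ∫ x in (0:ℝ)..(π/2), Real.log (x ^ 2 + Real.log (2 * Real.cos x) ^ 2)
      = ∫ x in (0:ℝ)..(π/2), 2 * F 1 (2 * x) := by
    apply intervalIntegral.integral_congr_ae
    filter_upwards [MeasureTheory.Measure.ae_ne MeasureTheory.volume (π / 2)] with x hx hI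
    rw [Set.uIoc_of_le (by linarith)] at hI
    rw [F_one hI.1.le (lt_of_le_of_ne hI.2 hx)]
    ring
  rw [h, intervalIntegral.integral_const_mul,
    intervalIntegral.integral_comp_mul_left (F 1) two_ne_zero,
    mul_zero, mul_div_cancel₀ π two_ne_zero, F_one_int]
  simp
end

section
/- For every real number r with 0 < r < 1/2 and every positive integer n, one has ∫_{−π/2}^{π/2} log( (−i x − n ln(1/r) + ln(2 cos x)) / (−i x + n ln(1/r) + ln(2 cos x)) ) dx = π · ln(1 − r^n), where log denotes the principal branch of the complex logarithm. -/
open Real Complex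

lemma ilr_dslope_re_pos (ρ : ℝ) (hρ : 0 < ρ) (u : ℂ) (hu : 0 < u.re) :
    0 < (dslope Complex.log (ρ : ℂ) u).re := by
  by_cases h : u = ρ
  · subst h
    rw [dslope_same, Complex.deriv_log (by simp [Complex.mem_slitPlane_iff, hρ]), ← ofReal_inv,
      ofReal_re]
    positivity
  have hne : u - ρ ≠ 0 := sub_ne_zero.2 h
  rw [dslope_of_ne _ h, slope_def_field]
  let g : ℝ → ℝ := fun t => (Complex.log (ρ + t * (u - ρ)) / (u - ρ)).re
  have hre : ∀ t ∈ Set.Icc (0:ℝ) 1, 0 < ((ρ:ℂ) + t * (u - ρ)).re := by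
    intro t ht
    have h1 : ((ρ:ℂ) + t * (u - ρ)).re = (1 - t) * ρ + t * u.re := by simp; ring
    rw [h1]
    rcases ht.1.eq_or_lt with h0 | h0
    · simp [← h0, hρ]
    · have := mul_pos h0 hu
      have := mul_nonneg (sub_nonneg.2 ht.2) hρ.le
      linarith
  have hd : ∀ t ∈ Set.Icc (0:ℝ) 1, HasDerivAt g (((ρ:ℂ) + t * (u - ρ))⁻¹).re t := by
    intro t ht
    have h1 : HasDerivAt (fun z : ℂ => (ρ:ℂ) + z * (u - ρ)) (u - ρ) (t : ℂ) := by
      simpa using ((hasDerivAt_id (t:ℂ)).mul_const (u - (ρ:ℂ))).const_add (ρ:ℂ)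
    have h2 := (h1.clog (Or.inl (hre t ht))).div_const (u - (ρ:ℂ))
    have h3 := h2.real_of_complex
    convert h3 using 2
    field_simp
  have hm : StrictMonoOn g (Set.Icc 0 1) := by
    apply strictMonoOn_of_deriv_pos (convex_Icc 0 1)
    · exact fun t ht => (hd t ht).continuousAt.continuousWithinAt
    · intro t ht
      have ht' := interior_subset ht
      rw [(hd t ht').deriv, Complex.inv_re]
      have := hre t ht'
      apply div_pos this
      rw [Complex.normSq_pos]
      intro h0; rw [h0] at this; simp at this
  have := hm (by simp) (by simp) (zero_lt_one)
  simp only [g] at this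
  rw [sub_div, Complex.sub_re]
  simpa using this

noncomputable def ilrK (ρ : ℝ) : ℂ → ℂ :=
  Function.update (fun u => (((-Real.log ρ : ℝ) : ℂ) - Complex.log u) / dslope Complex.log (ρ : ℂ) u) 0 ρ

lemma ilr_re_pos_of_mem {u : ℂ} (hu : u ∈ Metric.closedBall (1:ℂ) 1) (h0 : u ≠ 0) : 0 < u.re := by
  rw [Metric.mem_closedBall, Complex.dist_eq, ← sq_le_one_iff₀ (norm_nonneg _), ← Complex.normSq_eq_norm_sq,
    Complex.normSq_apply] at hu
  simp at hu
  have : 0 < u.re * u.re + u.im * u.im := by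
    rw [← Complex.normSq_apply]; exact Complex.normSq_pos.2 h0
  nlinarith

lemma ilr_sub_re_pos {ρ : ℝ} (hρ : 0 < ρ) (hρ2 : ρ < 1/2) {u : ℂ}
    (hu : u ∈ Metric.closedBall (1:ℂ) 1) (h0 : u ≠ 0) :
    0 < (((-Real.log ρ : ℝ) : ℂ) - Complex.log u).re := by
  rw [Complex.sub_re, ofReal_re, Complex.log_re]
  have h1 : ‖u‖ ≤ 2 := by
    rw [Metric.mem_closedBall, Complex.dist_eq] at hu
    have := norm_add_le (u - 1) 1
    simp at this; linarith
  have h2 : Real.log ‖u‖ ≤ Real.log 2 := Real.log_le_log (norm_pos_iff.2 h0) h1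
  have h3 : Real.log ρ < Real.log (1/2) := Real.log_lt_log hρ hρ2
  simp at h3
  linarith

lemma ilrK_mem {ρ : ℝ} (hρ : 0 < ρ) (hρ2 : ρ < 1/2) {u : ℂ}
    (hu : u ∈ Metric.closedBall (1:ℂ) 1) : ilrK ρ u ∈ Complex.slitPlane := by
  by_cases h0 : u = 0
  · subst h0; simp [ilrK, Complex.mem_slitPlane_iff, hρ]
  rw [ilrK, Function.update_of_ne h0]
  have ha := ilr_sub_re_pos hρ hρ2 hu h0
  have hb := ilr_dslope_re_pos ρ hρ u (ilr_re_pos_of_mem hu h0)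
  generalize ((-Real.log ρ : ℝ) : ℂ) - Complex.log u = a at *
  generalize dslope Complex.log (ρ : ℂ) u = b at *
  have hb0 : b ≠ 0 := by rintro rfl; simp at hb
  by_contra hc
  rw [Complex.mem_slitPlane_iff] at hc
  push Not at hc
  have : a = (a / b) * b := by field_simp
  have h2 := congrArg Complex.re this
  rw [Complex.mul_re, hc.2] at h2
  nlinarith [hc.1]

lemma ilrK_cont {ρ : ℝ} (hρ : 0 < ρ) :
    ContinuousOn (ilrK ρ) (Metric.closedBall (1:ℂ) 1) := by
  intro u hu
  by_cases h0 : u = 0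
  · subst h0
    unfold ilrK
    rw [continuousWithinAt_update_same]
    have hlog : Filter.Tendsto (fun u : ℂ => ‖((-Real.log ρ : ℝ) : ℂ) + Complex.log u‖)
        (nhdsWithin 0 (Metric.closedBall (1:ℂ) 1 \ {0})) Filter.atTop := by
      have h1 : Filter.Tendsto (fun u : ℂ => -(-Real.log ρ + Real.log ‖u‖))
          (nhdsWithin 0 (Metric.closedBall (1:ℂ) 1 \ {0})) Filter.atTop := by
        apply Filter.tendsto_neg_atBot_atTop.comp
        apply Filter.tendsto_atBot_add_const_left
        apply Real.tendsto_log_nhdsGT_zero.comp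
        exact tendsto_norm_nhdsNE_zero.mono_left (nhdsWithin_mono _ (fun x hx => hx.2))
      refine Filter.tendsto_atTop_mono (fun u => ?_) h1
      refine le_trans (neg_le_abs _) ?_
      have := Complex.abs_re_le_norm (((-Real.log ρ : ℝ) : ℂ) + Complex.log u)
      rwa [Complex.add_re, ofReal_re, Complex.log_re] at this
    have hinv : Filter.Tendsto (fun u : ℂ => (((-Real.log ρ : ℝ) : ℂ) + Complex.log u)⁻¹)
        (nhdsWithin 0 (Metric.closedBall (1:ℂ) 1 \ {0})) (nhds 0) := by
      rw [tendsto_zero_iff_norm_tendsto_zero]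
      simp_rw [norm_inv]
      exact hlog.inv_tendsto_atTop
    have hid : Filter.Tendsto (fun u : ℂ => u)
        (nhdsWithin 0 (Metric.closedBall (1:ℂ) 1 \ {0})) (nhds 0) :=
      Filter.tendsto_id.mono_left nhdsWithin_le_nhds
    have hmain := ((hinv.const_mul (2 * ((-Real.log ρ : ℝ) : ℂ))).sub_const 1).mul
      (hid.sub_const (ρ:ℂ))
    have he : (2 * ((-Real.log ρ : ℝ) : ℂ) * 0 - 1) * (0 - (ρ:ℂ)) = ρ := by ring
    rw [he] at hmain
    refine hmain.congr' ?_
    have hev : ∀ᶠ u : ℂ in nhdsWithin 0 (Metric.closedBall (1:ℂ) 1 \ {0}), u ≠ ρ := by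
      apply hid.eventually_ne
      exact_mod_cast hρ.ne
    filter_upwards [hev, hlog.eventually_gt_atTop 0] with u hu1 hu2
    rw [dslope_of_ne _ hu1, slope_def_field, ← ofReal_log hρ.le]
    have h3 := norm_pos_iff.1 hu2
    have h4 : u - ρ ≠ 0 := sub_ne_zero.2 hu1
    push_cast at h3 ⊢
    have h5 : Complex.log u - (Real.log ρ : ℂ) ≠ 0 := by rwa [sub_eq_neg_add]
    field_simp
    ring
  · have hre := ilr_re_pos_of_mem hu h0
    have hb := ilr_dslope_re_pos ρ hρ u hre
    apply ContinuousAt.continuousWithinAt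
    unfold ilrK
    rw [continuousAt_update_of_ne h0]
    apply ContinuousAt.div
    · exact continuousAt_const.sub (continuousAt_clog (Or.inl hre))
    · by_cases h : u = ρ
      · subst h
        rw [continuousAt_dslope_same]
        exact Complex.differentiableAt_log (Or.inl hre)
      · rw [continuousAt_dslope_of_ne h]
        exact continuousAt_clog (Or.inl hre)
    · intro h; rw [h] at hb; simp at hb

lemma ilrK_diff {ρ : ℝ} (hρ : 0 < ρ) {u : ℂ} (hu : u ∈ Metric.ball (1:ℂ) 1) (h : u ≠ ρ) :
    DifferentiableAt ℂ (ilrK ρ) u := by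
  have h0 : u ≠ 0 := by rintro rfl; simp at hu
  have hre := ilr_re_pos_of_mem (Metric.ball_subset_closedBall hu) h0
  have hb := ilr_dslope_re_pos ρ hρ u hre
  have : DifferentiableAt ℂ (fun u => (((-Real.log ρ : ℝ) : ℂ) - Complex.log u) / dslope Complex.log (ρ : ℂ) u) u := by
    apply DifferentiableAt.div
    · exact (differentiableAt_const _).sub (Complex.differentiableAt_log (Or.inl hre))
    · rw [differentiableAt_dslope_of_ne h]
      exact Complex.differentiableAt_log (Or.inl hre)
    · intro h; rw [h] at hb; simp at hb
  refine this.congr_of_eventuallyEq ?_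
  filter_upwards [eventually_ne_nhds h0] with v hv
  rw [ilrK, Function.update_of_ne hv]

lemma ilr_logK_cont {ρ : ℝ} (hρ : 0 < ρ) (hρ2 : ρ < 1/2) :
    ContinuousOn (fun u => Complex.log (ilrK ρ u)) (Metric.closedBall (1:ℂ) 1) :=
  (ilrK_cont hρ).clog (fun _ hu => ilrK_mem hρ hρ2 hu)

lemma ilr_avg_logK {ρ : ℝ} (hρ : 0 < ρ) (hρ2 : ρ < 1/2) :
    circleAverage (fun u => Complex.log (ilrK ρ u)) 1 1 = ((Real.log (1 - ρ) : ℝ) : ℂ) := by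
  rw [circleAverage_of_differentiable_on_off_countable (Set.countable_singleton (ρ:ℂ))]
  · have h1 : (1:ℂ) ≠ ρ := by exact_mod_cast (by linarith : (1:ℝ) ≠ ρ)
    rw [ilrK, Function.update_of_ne one_ne_zero, dslope_of_ne _ h1, slope_def_field,
      ← ofReal_log hρ.le, Complex.log_one, ofReal_log (show (0:ℝ) ≤ 1 - ρ by linarith)]
    congr 1
    have : Real.log ρ ≠ 0 := (Real.log_neg hρ (by linarith)).ne
    have : (Real.log ρ : ℂ) ≠ 0 := by exact_mod_cast this
    have : (1:ℂ) - ρ ≠ 0 := sub_ne_zero.2 h1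
    push_cast
    field_simp
    ring
  · simpa using ilr_logK_cont hρ hρ2
  · rintro z ⟨hz, hz2⟩
    rw [abs_one] at hz
    exact (ilrK_diff hρ hz hz2).clog (ilrK_mem hρ hρ2 (Metric.ball_subset_closedBall hz))

noncomputable def ilrG (ρ : ℝ) (u : ℂ) : ℝ := (Complex.log (ilrK ρ u)).re - Real.log ‖u - ρ‖

lemma ilr_ne {ρ : ℝ} (hρ : 0 < ρ) (hρ2 : ρ < 1/2) {u : ℂ} (hu : u ∈ Metric.sphere (1:ℂ) 1) :
    u - ρ ≠ 0 := by
  intro h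
  rw [sub_eq_zero.1 h, mem_sphere_iff_norm, ← ofReal_one, ← ofReal_sub, norm_real,
    Real.norm_eq_abs, abs_of_neg (by linarith)] at hu
  linarith

lemma ilrG_cont {ρ : ℝ} (hρ : 0 < ρ) (hρ2 : ρ < 1/2) :
    ContinuousOn (ilrG ρ) (Metric.sphere (1:ℂ) 1) := by
  apply ContinuousOn.sub
  · exact Complex.continuous_re.comp_continuousOn
      ((ilr_logK_cont hρ hρ2).mono Metric.sphere_subset_closedBall)
  · apply ContinuousOn.log
    · fun_prop
    · exact fun u hu => norm_ne_zero_iff.2 (ilr_ne hρ hρ2 hu)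

lemma ilr_avg_G {ρ : ℝ} (hρ : 0 < ρ) (hρ2 : ρ < 1/2) :
    circleAverage (ilrG ρ) 1 1 = Real.log (1 - ρ) := by
  have h1 : circleAverage (fun u : ℂ => Real.log ‖u - ρ‖) 1 1 = 0 := by
    rw [circleAverage_log_norm_sub_const_of_mem_closedBall]
    · simp
    · rw [mem_closedBall_iff_norm, ← ofReal_one, ← ofReal_sub, norm_real,
        Real.norm_eq_abs, abs_of_neg (by linarith)]
      simp; linarith
  have hc : ContinuousOn (fun u => Complex.log (ilrK ρ u)) (Metric.sphere (1:ℂ) 1) :=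
    ((ilr_logK_cont hρ hρ2).mono Metric.sphere_subset_closedBall)
  have h2 : circleAverage (fun u => (Complex.log (ilrK ρ u)).re) 1 1 = Real.log (1 - ρ) := by
    have h := congrArg Complex.re (ilr_avg_logK hρ hρ2)
    rw [ofReal_re] at h
    rw [← h, circleAverage, circleAverage, Complex.real_smul, Complex.re_ofReal_mul, smul_eq_mul]
    congr 1
    have := intervalIntegral.intervalIntegral_re (𝕜 := ℂ) (hc.circleIntegrable zero_le_one)
    exact this
  rw [← h2, ← sub_zero (circleAverage (fun u => (Complex.log (ilrK ρ u)).re) 1 1), ← h1,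
    ← circleAverage_sub]
  · rfl
  · exact (Complex.continuous_re.comp_continuousOn hc).circleIntegrable zero_le_one
  · apply ContinuousOn.circleIntegrable zero_le_one
    apply ContinuousOn.log
    · fun_prop
    · exact fun u hu => norm_ne_zero_iff.2 (ilr_ne hρ hρ2 hu)

lemma ilr_int_G {ρ : ℝ} (hρ : 0 < ρ) (hρ2 : ρ < 1/2) :
    ∫ x in (-(π/2))..(π/2), ilrG ρ (circleMap 1 1 (-2 * x)) = π * Real.log (1 - ρ) := by
  have h := ilr_avg_G hρ hρ2
  rw [circleAverage_eq_integral_add (-π)] at h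
  rw [intervalIntegral.integral_comp_mul_left (fun t => ilrG ρ (circleMap 1 1 t)) (by norm_num : (-2:ℝ) ≠ 0)]
  rw [intervalIntegral.integral_comp_add_right (fun t => ilrG ρ (circleMap 1 1 t))] at h
  rw [intervalIntegral.integral_symm]
  rw [← h]
  have e1 : (0:ℝ) + -π = -2 * (π/2) := by ring
  have e2 : 2 * π + -π = -2 * -(π/2) := by ring
  rw [e1, e2]
  simp only [smul_eq_mul]
  field_simp

lemma ilr_circleMap (x : ℝ) :
    circleMap 1 1 (-2 * x) = ((2 * Real.cos x : ℝ) : ℂ) * Complex.exp (-(I * x)) := by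
  rw [circleMap]
  push_cast
  rw [Complex.two_cos, add_mul, ← Complex.exp_add, ← Complex.exp_add]
  have e1 : (x:ℂ) * I + -(I * x) = 0 := by ring
  have e2 : -(x:ℂ) * I + -(I * x) = -2 * x * I := by ring
  rw [e1, e2]
  simp

lemma ilr_log_circleMap {x : ℝ} (hx : x ∈ Set.Ioo (-(π/2)) (π/2)) :
    Complex.log (circleMap 1 1 (-2 * x)) = -(I * x) + Real.log (2 * Real.cos x) := by
  have hc := Real.cos_pos_of_mem_Ioo hx
  rw [ilr_circleMap, Complex.log_ofReal_mul (by positivity) (Complex.exp_ne_zero _),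
    Complex.log_exp, add_comm]
  · simp; linarith [hx.2, Real.pi_pos]
  · simp; linarith [hx.1, Real.pi_pos]

/-- the integrand, with `L = -log ρ` -/
noncomputable def ilrF (L : ℝ) (x : ℝ) : ℂ :=
  Complex.log ((-(Complex.I * x) - L + Real.log (2 * Real.cos x)) /
           (-(Complex.I * x) + L + Real.log (2 * Real.cos x)))

lemma ilrF_re {ρ : ℝ} (hρ : 0 < ρ) (hρ2 : ρ < 1/2) {x : ℝ} (hx : x ∈ Set.Ioo (-(π/2)) (π/2)) :
    (ilrF (-Real.log ρ) x).re = ilrG ρ (circleMap 1 1 (-2 * x)) := by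
  have hc := Real.cos_pos_of_mem_Ioo hx
  have hl := ilr_log_circleMap hx
  have hs : circleMap 1 1 (-2 * x) ∈ Metric.sphere (1:ℂ) 1 :=
    circleMap_mem_sphere 1 zero_le_one _
  have h0 : circleMap 1 1 (-2 * x) ≠ 0 := by
    rw [ilr_circleMap]
    refine mul_ne_zero ?_ (Complex.exp_ne_zero _)
    exact_mod_cast (by positivity : 2 * Real.cos x ≠ 0)
  generalize circleMap 1 1 (-2 * x) = u at *
  have hne := ilr_ne hρ hρ2 hs
  have hcb := Metric.sphere_subset_closedBall hs
  have ha := ilr_sub_re_pos hρ hρ2 hcb h0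
  have hb := ilr_dslope_re_pos ρ hρ u (ilr_re_pos_of_mem hcb h0)
  rw [ilrF, ilrG, ilrK, Function.update_of_ne h0, Complex.log_re, Complex.log_re]
  rw [dslope_of_ne _ (sub_ne_zero.1 hne), slope_def_field, ← ofReal_log hρ.le] at *
  have e1 : -(I * (x:ℂ)) - ((-Real.log ρ : ℝ):ℂ) + Real.log (2 * Real.cos x)
    = -(((-Real.log ρ : ℝ):ℂ) - Complex.log u) := by rw [hl]; ring
  have e2 : -(I * (x:ℂ)) + ((-Real.log ρ : ℝ):ℂ) + Real.log (2 * Real.cos x)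
    = Complex.log u - Real.log ρ := by rw [hl]; push_cast; ring
  rw [e1, e2]
  have ha0 : ((-Real.log ρ : ℝ):ℂ) - Complex.log u ≠ 0 := by
    intro h; rw [h] at ha; simp at ha
  have hb0 : Complex.log u - Real.log ρ ≠ 0 := by
    intro h; rw [h] at hb; simp at hb
  have n1 := norm_ne_zero_iff.2 ha0
  have n2 := norm_ne_zero_iff.2 hb0
  have n3 := norm_ne_zero_iff.2 hne
  rw [norm_div, norm_div, norm_div, norm_neg, Real.log_div n1 n2,
    Real.log_div n1 (div_ne_zero n2 n3), Real.log_div n2 n3]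
  ring

lemma ilrG_cont' {ρ : ℝ} (hρ : 0 < ρ) (hρ2 : ρ < 1/2) :
    Continuous (fun x : ℝ => ilrG ρ (circleMap 1 1 (-2 * x))) := by
  apply (ilrG_cont hρ hρ2).comp_continuous
  · exact (continuous_circleMap 1 1).comp (by fun_prop)
  · intro x
    exact circleMap_mem_sphere 1 zero_le_one _

lemma ilr_ae : ∀ᵐ x : ℝ, x ∈ Set.uIoc (-(π/2)) (π/2) → x ∈ Set.Ioo (-(π/2)) (π/2) ∧ x ≠ 0 := by
  filter_upwards [MeasureTheory.Measure.ae_ne MeasureTheory.volume (π/2),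
    MeasureTheory.Measure.ae_ne MeasureTheory.volume (0:ℝ)] with x h1 h2 hx
  rw [Set.uIoc_of_le (by linarith [Real.pi_pos])] at hx
  exact ⟨⟨hx.1, lt_of_le_of_ne hx.2 h1⟩, h2⟩

lemma ilrF_int {ρ : ℝ} (hρ : 0 < ρ) (hρ2 : ρ < 1/2) :
    IntervalIntegrable (ilrF (-Real.log ρ)) MeasureTheory.volume (-(π/2)) (π/2) := by
  have hg : IntervalIntegrable (fun x : ℝ => |ilrG ρ (circleMap 1 1 (-2 * x))| + π)
      MeasureTheory.volume (-(π/2)) (π/2) :=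
    ((ilrG_cont' hρ hρ2).abs.add continuous_const).intervalIntegrable _ _
  refine hg.mono_fun' ?_ ?_
  · apply Measurable.aestronglyMeasurable
    unfold ilrF
    fun_prop
  · rw [Filter.EventuallyLE, MeasureTheory.ae_restrict_iff' measurableSet_uIoc]
    filter_upwards [ilr_ae] with x hx h
    rw [← ilrF_re hρ hρ2 (hx h).1]
    refine (Complex.norm_le_abs_re_add_abs_im _).trans ?_
    gcongr
    rw [ilrF, Complex.log_im]
    exact Complex.abs_arg_le_pi _

lemma ilrF_neg {L : ℝ} (hL : L ≠ 0) {x : ℝ} (hx : x ≠ 0) :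
    ilrF L (-x) = (starRingEnd ℂ) (ilrF L x) := by
  rw [ilrF, ilrF, ← Complex.log_conj]
  · congr 1
    simp
  · intro h
    rw [Complex.arg_eq_pi_iff] at h
    have h2 := h.2
    have e : (-(I * (x:ℂ)) - L + Real.log (2 * Real.cos x)) =
      (-(I * (x:ℂ)) + L + Real.log (2 * Real.cos x)) - 2 * L := by ring
    have hd : (-(I * (x:ℂ)) + L + Real.log (2 * Real.cos x)).im = -x := by simp
    rw [e] at h2
    generalize (-(I * (x:ℂ)) + L + Real.log (2 * Real.cos x)) = d at *
    have hd0 : d ≠ 0 := by rintro rfl; simp at hd; exact hx hd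
    rw [sub_div, div_self hd0, div_eq_mul_inv, ← ofReal_ofNat, ← ofReal_mul, Complex.sub_im, Complex.im_ofReal_mul,
      Complex.inv_im, hd] at h2
    have := Complex.normSq_pos.2 hd0
    simp at h2
    rcases h2 with h2 | h2 | h2
    · exact hL h2
    · exact hx h2
    · exact hd0 h2

/-- For `0 < r < 1/2` and a positive integer `n`,
`∫_{-π/2}^{π/2} log((−ix − n ln(1/r) + ln(2cos x)) / (−ix + n ln(1/r) + ln(2cos x))) dx
  = π ln(1 − rⁿ)`. -/
theorem integral_log_ratio (r : ℝ) (hr0 : 0 < r) (hr : r < 1/2) (n : ℕ) (hn : 0 < n) :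
    ∫ x in (-(π/2))..(π/2),
        Complex.log
          ((-(Complex.I * x) - n * Real.log (1 / r) + Real.log (2 * Real.cos x)) /
           (-(Complex.I * x) + n * Real.log (1 / r) + Real.log (2 * Real.cos x)))
    = π * Real.log (1 - r ^ n) := by
  have hρ : 0 < r ^ n := pow_pos hr0 n
  have hρ2 : r ^ n < 1/2 :=
    (pow_le_of_le_one hr0.le (by linarith) hn.ne').trans_lt hr
  have hL : -Real.log (r ^ n) ≠ 0 := (neg_pos.2 (Real.log_neg hρ (by linarith))).ne'
  have hf : (fun x : ℝ => Complex.log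
          ((-(Complex.I * x) - n * Real.log (1 / r) + Real.log (2 * Real.cos x)) /
           (-(Complex.I * x) + n * Real.log (1 / r) + Real.log (2 * Real.cos x))))
      = ilrF (-Real.log (r ^ n)) := by
    have : ((-Real.log (r ^ n) : ℝ) : ℂ) = n * Real.log (1 / r) := by
      rw [Real.log_pow, one_div, Real.log_inv]; push_cast; ring
    funext x
    rw [ilrF, this]
  rw [hf]
  generalize r ^ n = ρ at *
  have hconj : (starRingEnd ℂ) (∫ x in (-(π/2))..(π/2), ilrF (-Real.log ρ) x)
      = ∫ x in (-(π/2))..(π/2), ilrF (-Real.log ρ) x := by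
    rw [← intervalIntegral.intervalIntegral_conj]
    have h1 := intervalIntegral.integral_comp_neg (a := -(π/2)) (b := π/2) (ilrF (-Real.log ρ))
    rw [neg_neg] at h1
    rw [← h1]
    symm
    apply intervalIntegral.integral_congr_ae
    filter_upwards [ilr_ae] with x hx h
    exact ilrF_neg hL (hx h).2
  rw [← Complex.conj_eq_iff_re.1 hconj]
  have hre : (∫ x in (-(π/2))..(π/2), ilrF (-Real.log ρ) x).re = π * Real.log (1 - ρ) := by
    rw [← ilr_int_G hρ hρ2]
    refine (intervalIntegral.intervalIntegral_re (𝕜 := ℂ) (ilrF_int hρ hρ2)).symm.trans ?_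
    apply intervalIntegral.integral_congr_ae
    filter_upwards [ilr_ae] with x hx h
    exact ilrF_re hρ hρ2 (hx h).1
  rw [hre]
  push_cast
  rfl
end

section
/- For every complex number β with Re β > −1 and every nonzero real number a with a ≠ ln 2, one has ∫_{−π/2}^{π/2} (1 + e^{−2ix})^β / ( log(1 + e^{−2ix}) − a ) dx = −π/a + π · e^{(β+1)a}/(e^a − 1) · H(ln 2 − a), where H is the Heaviside step function, H(t) = 1 for t > 0 and H(t) = 0 for t < 0. -/
open Real Complex

/-- The Heaviside step function: `H(t) = 1` for `t > 0` and `H(t) = 0` otherwise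
(here it is only ever evaluated at nonzero arguments). -/
noncomputable def heaviside (t : ℝ) : ℝ := if 0 < t then 1 else 0

open Filter Topology MeasureTheory

noncomputable def FF (β : ℂ) (a : ℝ) (z : ℂ) : ℂ :=
  (1 + z) ^ β / (Complex.log (1 + z) - a)

lemma FF_p_ne (a : ℝ) (ha' : a ≠ Real.log 2) : |Real.exp a - 1| ≠ 1 := by
  intro h
  have h0 := Real.exp_pos a
  rcases abs_eq (by norm_num : (0:ℝ) ≤ 1) |>.1 h with h | h
  · apply ha'
    rw [show (2:ℝ) = Real.exp a by linarith, Real.log_exp]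
  · linarith

lemma FF_log_eq (a : ℝ) (z : ℂ) (hz : 1 + z ≠ 0) (h : Complex.log (1 + z) - a = 0) :
    z = ((Real.exp a - 1 : ℝ) : ℂ) := by
  have h1 : Complex.log (1 + z) = a := sub_eq_zero.1 h
  have h2 := Complex.exp_log hz
  rw [h1] at h2
  push_cast
  rw [h2]; ring

lemma FF_log_lower (a : ℝ) (z : ℂ) (hz : 1 + z ≠ 0) :
    min 1 (abs (‖z‖ - abs (Real.exp a - 1)) / (2 * Real.exp a)) ≤ ‖Complex.log (1 + z) - a‖ := by
  by_contra! hlt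
  have h1 : ‖Complex.log (1 + z) - a‖ < 1 := lt_of_lt_of_le hlt (min_le_left _ _)
  have h2 := lt_of_lt_of_le hlt (min_le_right _ _)
  have h3 := Complex.norm_exp_sub_one_le h1.le
  rw [Complex.exp_sub, Complex.exp_log hz] at h3
  have h0 := Real.exp_pos a
  have e0 : Complex.exp a ≠ 0 := Complex.exp_ne_zero _
  have h4 : (1 + z) / Complex.exp a - 1 = (z - ((Real.exp a - 1 : ℝ) : ℂ)) / Complex.exp a := by
    push_cast; field_simp; ring
  rw [h4, norm_div, Complex.norm_exp, Complex.ofReal_re, div_le_iff₀ h0] at h3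
  have h5 := abs_norm_sub_norm_le z ((Real.exp a - 1 : ℝ) : ℂ)
  rw [Complex.norm_real, Real.norm_eq_abs] at h5
  rw [lt_div_iff₀ (by positivity)] at h2
  nlinarith

lemma FF_circle (β : ℂ) (a : ℝ) (ha : a ≠ 0) (r : ℝ) (hr0 : 0 < r) (hr : r < 1)
    (hp : |Real.exp a - 1| < 1 → |Real.exp a - 1| < r) :
    (∮ z in C(0, r), z⁻¹ * FF β a z) = 2 * π * I * (-1 / a + Complex.exp ((β + 1) * a) /
      (Complex.exp a - 1) * heaviside (Real.log 2 - a)) := by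
  have hmem : ∀ z ∈ Metric.ball (0:ℂ) 1, 1 + z ∈ slitPlane := fun z hz =>
    Complex.mem_slitPlane_of_norm_lt_one (by simpa using hz)
  have hsub : Metric.closedBall (0:ℂ) r ⊆ Metric.ball 0 1 := Metric.closedBall_subset_ball hr
  have hlogd : DifferentiableOn ℂ (fun z : ℂ => Complex.log (1 + z)) (Metric.ball 0 1) := by
    intro z hz
    exact ((differentiableAt_id.const_add 1).clog (hmem z hz)).differentiableWithinAt
  have hpowd : DifferentiableOn ℂ (fun z : ℂ => (1 + z) ^ β) (Metric.ball 0 1) := by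
    intro z hz
    exact ((differentiableAt_id.const_add 1).cpow (differentiableAt_const _)
      (hmem z hz)).differentiableWithinAt
  have hcauchy : ∀ (G : ℂ → ℂ), DifferentiableOn ℂ G (Metric.ball 0 1) →
      ∀ w ∈ Metric.ball (0:ℂ) r, (∮ z in C(0, r), (z - w)⁻¹ * G z) = 2 * π * I * G w := by
    intro G hG w hw
    have := DifferentiableOn.circleIntegral_sub_inv_smul (hG.mono hsub) hw
    simpa only [smul_eq_mul] using this
  have haC : (a : ℂ) ≠ 0 := by exact_mod_cast ha
  by_cases hlt : a < Real.log 2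
  · have he2 : Real.exp a < 2 := by
      rw [← Real.exp_log (by norm_num : (0:ℝ) < 2)]; exact Real.exp_lt_exp.2 hlt
    have he0 := Real.exp_pos a
    have hp1 : |Real.exp a - 1| < 1 := by rw [abs_lt]; constructor <;> linarith
    have hpr := hp hp1
    set p : ℂ := ((Real.exp a - 1 : ℝ) : ℂ) with hpdef
    have hpe : 1 + p = Complex.exp a := by rw [hpdef]; push_cast; ring
    have hpe' : Complex.exp a - 1 = p := by rw [← hpe]; ring
    have hpn : ‖p‖ = |Real.exp a - 1| := by rw [hpdef, Complex.norm_real, Real.norm_eq_abs]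
    have hp0 : p ≠ 0 := by
      rw [hpdef]; norm_cast
      intro h; apply ha
      exact Real.exp_eq_one_iff a |>.1 (by linarith)
    have hpball : p ∈ Metric.ball (0:ℂ) 1 := by simpa [hpn] using hp1
    have hpballr : p ∈ Metric.ball (0:ℂ) r := by simpa [hpn] using hpr
    have hlogp : Complex.log (1 + p) = a := by
      rw [hpe, ← Complex.ofReal_exp, ← Complex.ofReal_log he0.le, Real.log_exp]
    set D : ℂ → ℂ := dslope (fun z : ℂ => Complex.log (1 + z)) p with hD
    have hDd : DifferentiableOn ℂ D (Metric.ball 0 1) :=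
      (Complex.differentiableOn_dslope (Metric.isOpen_ball.mem_nhds hpball)).2 hlogd
    have hDne : ∀ z, z ≠ p → D z = (Complex.log (1 + z) - a) / (z - p) := by
      intro z hz
      rw [hD, dslope_of_ne _ hz, slope_def_field, hlogp]
    have hDp : D p = (Complex.exp a)⁻¹ := by
      rw [hD, dslope_same, ← hpe]
      have : HasDerivAt (fun z : ℂ => Complex.log (1 + z)) (1 / (1 + p)) p :=
        ((hasDerivAt_id p).const_add 1).clog (hmem p hpball)
      rw [this.deriv, one_div]
    have hD0 : ∀ z ∈ Metric.ball (0:ℂ) 1, D z ≠ 0 := by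
      intro z hz
      by_cases h : z = p
      · rw [h, hDp]; exact inv_ne_zero (Complex.exp_ne_zero _)
      · rw [hDne z h]
        refine div_ne_zero (fun h' => h ?_) (sub_ne_zero.2 h)
        exact FF_log_eq a z (slitPlane_ne_zero (hmem z hz)) h'
    have hG : DifferentiableOn ℂ (fun z => (1 + z) ^ β / D z) (Metric.ball 0 1) :=
      hpowd.div hDd hD0
    have hGc : ContinuousOn (fun z => (1 + z) ^ β / D z) (Metric.sphere 0 r) :=
      hG.continuousOn.mono (Metric.sphere_subset_closedBall.trans hsub)
    have key : ∀ w ∈ Metric.ball (0:ℂ) r,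
        CircleIntegrable (fun z => (z - w)⁻¹ * ((1 + z) ^ β / D z)) 0 r := by
      intro w hw
      apply ContinuousOn.circleIntegrable hr0.le
      refine ContinuousOn.mul (ContinuousOn.inv₀ (by fun_prop) ?_) hGc
      intro z hz h
      rw [sub_eq_zero] at h
      subst h
      simp at hz hw
      linarith
    have h0ball : (0:ℂ) ∈ Metric.ball (0:ℂ) r := by simpa using hr0
    have hE : Set.EqOn (fun z => z⁻¹ * FF β a z) (fun z => p⁻¹ * ((z - p)⁻¹ * ((1 + z) ^ β / D z)
        - (z - 0)⁻¹ * ((1 + z) ^ β / D z))) (Metric.sphere 0 r) := by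
      intro z hz
      have hzn : ‖z‖ = r := by simpa using hz
      have hz0 : z ≠ 0 := by intro h; rw [h, norm_zero] at hzn; linarith
      have hzp : z ≠ p := by intro h; rw [h, hpn] at hzn; linarith
      have hzp' : z - p ≠ 0 := sub_ne_zero.2 hzp
      have hz1 : z ∈ Metric.ball (0:ℂ) 1 := by simpa [hzn] using hr
      have hL : Complex.log (1 + z) - a ≠ 0 := fun h' =>
        hzp (FF_log_eq a z (slitPlane_ne_zero (hmem z hz1)) h')
      simp only [FF, hDne z hzp, sub_zero]
      field_simp
      ring
    rw [circleIntegral.integral_congr hr0.le hE, circleIntegral.integral_const_mul,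
      circleIntegral.integral_sub (key p hpballr) (key 0 h0ball),
      hcauchy _ hG p hpballr, hcauchy _ hG 0 h0ball, hDp, hDne 0 (Ne.symm hp0), hpe, hpe']
    have hH : heaviside (Real.log 2 - a) = 1 := by simp [heaviside, hlt]
    have hx : Complex.exp a ^ β = Complex.exp (β * a) := by
      rw [Complex.cpow_def_of_ne_zero (Complex.exp_ne_zero _), ← hpe, hlogp, mul_comm]
    rw [hH, hx, add_mul, one_mul, Complex.exp_add]
    simp only [add_zero, Complex.log_one, Complex.one_cpow, zero_sub, Complex.ofReal_one]
    field_simp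
    ring
  · have hne : ∀ z ∈ Metric.ball (0:ℂ) 1, Complex.log (1 + z) - a ≠ 0 := by
      intro z hz h
      have h1 := FF_log_eq a z (slitPlane_ne_zero (hmem z hz)) h
      have h2 : ‖z‖ < 1 := by simpa using hz
      rw [h1, Complex.norm_real, Real.norm_eq_abs, abs_lt] at h2
      have : Real.exp (Real.log 2) ≤ Real.exp a := Real.exp_le_exp.2 (not_lt.1 hlt)
      rw [Real.exp_log (by norm_num)] at this
      linarith
    have hF : DifferentiableOn ℂ (FF β a) (Metric.ball 0 1) :=
      hpowd.div (hlogd.sub_const _) hne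
    have := hcauchy _ hF 0 (by simpa using hr0)
    simp only [sub_zero] at this
    rw [this]
    have hH : heaviside (Real.log 2 - a) = 0 := by simp [heaviside, not_lt.1 hlt]
    rw [hH]
    simp [FF, neg_div]

lemma FF_circle' (β : ℂ) (a : ℝ) (ha : a ≠ 0) (r : ℝ) (hr0 : 0 < r) (hr : r < 1)
    (hp : |Real.exp a - 1| < 1 → |Real.exp a - 1| < r) :
    (∫ θ in (0:ℝ)..2 * π, FF β a (circleMap 0 r θ)) =
      2 * π * (-1 / a + Complex.exp ((β + 1) * a) /
      (Complex.exp a - 1) * heaviside (Real.log 2 - a)) := by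
  have h := FF_circle β a ha r hr0 hr hp
  rw [circleIntegral] at h
  have h2 : ∀ θ : ℝ, deriv (circleMap 0 r) θ • ((circleMap 0 r θ)⁻¹ * FF β a (circleMap 0 r θ))
      = I * FF β a (circleMap 0 r θ) := by
    intro θ
    have : circleMap 0 r θ ≠ 0 := circleMap_ne_center hr0.ne'
    rw [deriv_circleMap, smul_eq_mul]
    field_simp
  simp only [h2, intervalIntegral.integral_const_mul] at h
  apply mul_left_cancel₀ I_ne_zero
  rw [h]; ring

lemma FF_norm_lower (r θ : ℝ) (hr0 : 0 < r) (hr : r ≤ 1) (hθ : θ ∈ Set.Icc 0 (2 * π)) :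
    |θ - π| / π ≤ ‖1 + circleMap 0 r θ‖ := by
  have hπ := Real.pi_pos
  have h1 : ‖1 + Complex.exp (θ * I)‖ ≤ 2 * ‖1 + circleMap 0 r θ‖ := by
    have e1 : ‖circleMap 0 r θ‖ = r := by simp [abs_of_pos hr0]
    have e2 : 1 - r ≤ ‖1 + circleMap 0 r θ‖ := by
      have := norm_sub_le_norm_add (1:ℂ) (circleMap 0 r θ)
      rw [e1, norm_one] at this
      exact this
    have e3 : 1 + Complex.exp (θ * I) = (1 + circleMap 0 r θ) + (1 - r : ℝ) * Complex.exp (θ * I) := by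
      simp only [circleMap]; push_cast; ring
    rw [e3]
    refine (norm_add_le _ _).trans ?_
    rw [norm_mul, Complex.norm_exp_ofReal_mul_I, Complex.norm_real, Real.norm_eq_abs,
      abs_of_nonneg (by linarith)]
    linarith
  have h2 : ‖1 + Complex.exp (θ * I)‖ = ‖2 * Real.sin ((θ - π) / 2)‖ := by
    rw [← Complex.norm_exp_I_mul_ofReal_sub_one]
    have : Complex.exp (I * ((θ - π : ℝ) : ℂ)) = - Complex.exp (θ * I) := by
      rw [show I * ((θ - π : ℝ) : ℂ) = θ * I - π * I by push_cast; ring, Complex.exp_sub,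
        Complex.exp_pi_mul_I, div_neg, div_one]
    rw [this, ← norm_neg]; congr 1; ring
  have h3 : 2 / π * |(θ - π) / 2| ≤ |Real.sin ((θ - π) / 2)| := by
    apply Real.mul_abs_le_abs_sin
    rw [abs_le]; constructor <;> linarith [hθ.1, hθ.2]
  rw [h2, Real.norm_eq_abs, abs_mul, abs_two] at h1
  rw [abs_div, abs_two] at h3
  have : 2 / π * (|θ - π| / 2) = |θ - π| / π := by field_simp
  linarith

lemma FF_slit (θ : ℝ) (h : 1 + circleMap 0 1 θ ≠ 0) : 1 + circleMap 0 1 θ ∈ slitPlane := by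
  have hre : (1 + circleMap 0 1 θ).re = 1 + Real.cos θ := by
    simp [circleMap, Complex.exp_ofReal_mul_I_re]
  have him : (1 + circleMap 0 1 θ).im = Real.sin θ := by
    simp [circleMap, Complex.exp_ofReal_mul_I_im]
  rw [Complex.mem_slitPlane_iff]
  by_contra! hc
  rw [hre, him] at hc
  apply h
  apply Complex.ext
  · rw [hre]
    have := Real.sin_sq_add_cos_sq θ
    have h1 := Real.neg_one_le_cos θ
    simp; linarith [hc.1]
  · rw [him]; simpa using hc.2

lemma FF_integrable (s : ℝ) (hs : -1 < s) :
    IntervalIntegrable (fun θ : ℝ => |θ - π| ^ s) volume 0 (2 * π) := by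
  have hπ := Real.pi_pos
  have h0 : IntervalIntegrable (fun x : ℝ => x ^ s) volume 0 π :=
    intervalIntegral.intervalIntegrable_rpow' hs
  have h1 : IntervalIntegrable (fun θ : ℝ => |θ - π| ^ s) volume 0 π := by
    have := (h0.comp_sub_left π).symm
    simp only [sub_self, sub_zero] at this
    refine this.congr ?_
    intro x hx
    rw [Set.uIoc_of_le hπ.le] at hx
    simp only
    rw [abs_of_nonpos (by linarith [hx.2])]; congr 1; ring
  have h2 : IntervalIntegrable (fun θ : ℝ => |θ - π| ^ s) volume π (2 * π) := by
    have := (h0.comp_sub_right π)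
    rw [zero_add, ← two_mul] at this
    refine this.congr ?_
    intro x hx
    rw [Set.uIoc_of_le (by linarith)] at hx
    simp only
    rw [abs_of_nonneg (by linarith [hx.1])]
  exact h1.trans h2

lemma FF_num_bound (β : ℂ) (r θ : ℝ) (hr0 : 0 < r) (hr : r ≤ 1) (hθ : θ ∈ Set.Icc 0 (2 * π))
    (hne : θ ≠ π) :
    ‖(1 + circleMap 0 r θ) ^ β‖ ≤
      (2 ^ β.re + (1 / π) ^ β.re * |θ - π| ^ β.re) * Real.exp (π * |β.im|) := by
  have hπ := Real.pi_pos
  have hl := FF_norm_lower r θ hr0 hr hθ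
  have hpos : 0 < |θ - π| := abs_pos.2 (sub_ne_zero.2 hne)
  have hpos' : 0 < |θ - π| / π := by positivity
  have hw : 1 + circleMap 0 r θ ≠ 0 := norm_pos_iff.1 (lt_of_lt_of_le hpos' hl)
  have hu : ‖1 + circleMap 0 r θ‖ ≤ 2 := by
    refine (norm_add_le _ _).trans ?_
    simp [abs_of_pos hr0]; linarith
  rw [Complex.norm_cpow_of_ne_zero hw, div_eq_mul_inv, ← Real.exp_neg]
  have hA : (0:ℝ) ≤ 2 ^ β.re := by positivity
  have hB : (0:ℝ) ≤ (1 / π) ^ β.re * |θ - π| ^ β.re := by positivity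
  have hle : -(Complex.arg (1 + circleMap 0 r θ) * β.im) ≤ π * |β.im| := by
    refine (neg_le_abs _).trans ?_
    rw [abs_mul]
    exact mul_le_mul_of_nonneg_right (Complex.abs_arg_le_pi _) (abs_nonneg _)
  have hm : ‖1 + circleMap 0 r θ‖ ^ β.re ≤ 2 ^ β.re + (1 / π) ^ β.re * |θ - π| ^ β.re := by
    rcases le_total 0 β.re with h | h
    · have := Real.rpow_le_rpow (norm_nonneg _) hu h
      linarith
    · have := Real.rpow_le_rpow_of_nonpos hpos' hl h
      rw [show |θ - π| / π = 1 / π * |θ - π| by ring, Real.mul_rpow (by positivity) hpos.le] at this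
      linarith
  exact mul_le_mul hm (Real.exp_le_exp.2 hle) (Real.exp_pos _).le (by positivity)

lemma FF_limit (β : ℂ) (hβ : -1 < β.re) (a : ℝ) (ha' : a ≠ Real.log 2) :
    Tendsto (fun r : ℝ => ∫ θ in (0:ℝ)..2 * π, FF β a (circleMap 0 r θ)) (𝓝[<] 1)
      (𝓝 (∫ θ in (0:ℝ)..2 * π, FF β a (circleMap 0 1 θ))) := by
  have hπ := Real.pi_pos
  have hpne := FF_p_ne a ha'
  set q := |Real.exp a - 1| with hq
  have hc : 0 < |1 - q| := abs_pos.2 (sub_ne_zero.2 (Ne.symm hpne))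
  set m : ℝ := min 1 (|1 - q| / 2 / (2 * Real.exp a)) with hm
  have hm0 : 0 < m := by
    have := Real.exp_pos a
    rw [hm]; positivity
  have hev : ∀ᶠ r : ℝ in 𝓝[<] 1, 0 < r ∧ r < 1 ∧ |1 - q| / 2 ≤ |r - q| := by
    have h1 : ∀ᶠ r : ℝ in 𝓝 (1:ℝ), 0 < r := lt_mem_nhds one_pos
    have h2 : ∀ᶠ r : ℝ in 𝓝 (1:ℝ), |1 - q| / 2 < |r - q| := by
      have : Tendsto (fun r : ℝ => |r - q|) (𝓝 1) (𝓝 |1 - q|) :=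
        Continuous.tendsto (by fun_prop) 1
      exact this.eventually_const_lt (by linarith)
    filter_upwards [h1.filter_mono nhdsWithin_le_nhds, h2.filter_mono nhdsWithin_le_nhds,
      self_mem_nhdsWithin] with r h1 h2 h3
    exact ⟨h1, h3, h2.le⟩
  have hae : ∀ᵐ θ : ℝ ∂volume, θ ≠ π := by
    simp [ae_iff, measure_singleton]
  refine intervalIntegral.tendsto_integral_filter_of_dominated_convergence
    (fun θ => (2 ^ β.re + (1 / π) ^ β.re * |θ - π| ^ β.re) * Real.exp (π * |β.im|) / m)
    ?_ ?_ ?_ ?_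
  · refine Eventually.of_forall fun r => ?_
    apply Measurable.aestronglyMeasurable
    have hcm : Measurable (fun θ : ℝ => 1 + circleMap 0 r θ) :=
      ((continuous_circleMap 0 r).const_add 1 |>.measurable)
    exact (hcm.pow_const β).div ((Complex.measurable_log.comp hcm).sub_const _)
  · filter_upwards [hev] with r ⟨hr0, hr1, hrq⟩
    filter_upwards [hae] with θ hne hθ
    rw [Set.uIoc_of_le (by positivity)] at hθ
    have hθ' : θ ∈ Set.Icc 0 (2 * π) := ⟨hθ.1.le, hθ.2⟩
    have hw : 1 + circleMap 0 r θ ≠ 0 := by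
      have hl := FF_norm_lower r θ hr0 hr1.le hθ'
      have hpos : 0 < |θ - π| := abs_pos.2 (sub_ne_zero.2 hne)
      exact norm_pos_iff.1 (lt_of_lt_of_le (by positivity) hl)
    have h1 := FF_log_lower a (circleMap 0 r θ) hw
    have e1 : ‖circleMap 0 r θ‖ = r := by simp [abs_of_pos hr0]
    rw [e1] at h1
    have h2 : m ≤ ‖Complex.log (1 + circleMap 0 r θ) - a‖ := by
      refine le_trans ?_ h1
      have := Real.exp_pos a
      rw [hm]; gcongr
    rw [FF, norm_div]
    have := FF_num_bound β r θ hr0 hr1.le hθ' hne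
    exact div_le_div₀ (by positivity) this hm0 h2
  · exact (((intervalIntegrable_const).add ((FF_integrable _ hβ).const_mul _)).mul_const _).div_const _
  · filter_upwards [hae] with θ hne hθ
    rw [Set.uIoc_of_le (by positivity)] at hθ
    have hθ' : θ ∈ Set.Icc 0 (2 * π) := ⟨hθ.1.le, hθ.2⟩
    have hw : 1 + circleMap 0 1 θ ≠ 0 := by
      have hl := FF_norm_lower 1 θ one_pos le_rfl hθ'
      have hpos : 0 < |θ - π| := abs_pos.2 (sub_ne_zero.2 hne)
      exact norm_pos_iff.1 (lt_of_lt_of_le (by positivity) hl)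
    have hs := FF_slit θ hw
    have hL : Complex.log (1 + circleMap 0 1 θ) - a ≠ 0 := by
      intro h
      have h1 := FF_log_eq a _ hw h
      have h2 := congrArg norm h1
      rw [Complex.norm_real, Real.norm_eq_abs] at h2
      simp at h2
      exact hpne h2.symm
    have hcm : ContinuousAt (fun r : ℝ => 1 + circleMap 0 r θ) 1 := by
      simp only [circleMap]; fun_prop
    have : ContinuousAt (fun r : ℝ => FF β a (circleMap 0 r θ)) 1 :=
      (hcm.cpow continuousAt_const hs).div ((hcm.clog hs).sub continuousAt_const) hL
    exact this.tendsto.mono_left nhdsWithin_le_nhds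

/-- For complex `β` with `Re β > -1` and nonzero real `a` with `a ≠ ln 2`,
`∫_{-π/2}^{π/2} (1+e^{-2ix})^β / (log(1+e^{-2ix}) − a) dx
  = −π/a + π e^{(β+1)a}/(e^a − 1) · H(ln 2 − a)`. -/
theorem integral_cpow_div_log_sub (β : ℂ) (hβ : -1 < β.re)
    (a : ℝ) (ha : a ≠ 0) (ha' : a ≠ Real.log 2) :
    ∫ x in (-(π/2))..(π/2),
        (1 + Complex.exp (-2 * Complex.I * x)) ^ β /
          (Complex.log (1 + Complex.exp (-2 * Complex.I * x)) - a)
    = -π / a + π * Complex.exp ((β + 1) * a) / (Complex.exp a - 1) *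
        heaviside (Real.log 2 - a) := by
  have hlim := FF_limit β hβ a ha'
  have hev : ∀ᶠ r : ℝ in 𝓝[<] 1, (∫ θ in (0:ℝ)..2 * π, FF β a (circleMap 0 r θ)) =
      2 * π * (-1 / a + Complex.exp ((β + 1) * a) /
      (Complex.exp a - 1) * heaviside (Real.log 2 - a)) := by
    have h1 : ∀ᶠ r : ℝ in 𝓝 (1:ℝ), 0 < r := lt_mem_nhds one_pos
    have h2 : ∀ᶠ r : ℝ in 𝓝 (1:ℝ), |Real.exp a - 1| < 1 → |Real.exp a - 1| < r := by
      by_cases h : |Real.exp a - 1| < 1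
      · filter_upwards [lt_mem_nhds h] with r hr _ using hr
      · exact Eventually.of_forall fun r h' => absurd h' h
    filter_upwards [h1.filter_mono nhdsWithin_le_nhds, h2.filter_mono nhdsWithin_le_nhds,
      self_mem_nhdsWithin] with r h1 h2 h3
    exact FF_circle' β a ha r h1 h3 h2
  have hval := tendsto_nhds_unique hlim (tendsto_const_nhds.congr' (hev.mono fun _ h => h.symm))
  have hfun : ∀ x : ℝ, (1 + Complex.exp (-2 * Complex.I * x)) ^ β /
      (Complex.log (1 + Complex.exp (-2 * Complex.I * x)) - a) =
      (fun θ : ℝ => FF β a (circleMap 0 1 θ)) (-2 * x) := by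
    intro x
    have : circleMap 0 1 (-2 * x) = Complex.exp (-2 * Complex.I * x) := by
      simp only [circleMap]; push_cast
      rw [zero_add, one_mul]; congr 1; ring
    simp only [FF, this]
  simp only [hfun]
  rw [intervalIntegral.integral_comp_mul_left (fun θ : ℝ => FF β a (circleMap 0 1 θ))
    (by norm_num : (-2:ℝ) ≠ 0)]
  have hper : Function.Periodic (fun θ : ℝ => FF β a (circleMap 0 1 θ)) (2 * π) := fun θ => by
    simp only [(periodic_circleMap 0 1) θ]
  have hp := hper.intervalIntegral_add_eq (-π) 0
  rw [show -π + 2 * π = π by ring, zero_add, hval] at hp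
  rw [show -2 * -(π / 2) = π by ring, show -2 * (π / 2) = -π by ring,
    intervalIntegral.integral_symm, hp, Complex.real_smul]
  push_cast
  ring
end
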